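/- Let n ≥ r ≥ 1 be positive integers. The r-th elementary symmetric function of 1, 1/2, …, 1/n, namely H_n(1, 1, …, 1) = Σ_{1 ≤ k₁ < ⋯ < k_r ≤ n} 1/(k₁ ⋯ k_r), is an integer only for (n, r) = (1, 1) and (n, r) = (3, 2), where it equals 1 in both cases. -/

import Mathlib

/-- The multiple harmonic sum
`H_n(s₁, …, s_r) = ∑_{1 ≤ k₁ < ⋯ < k_r ≤ n} 1/(k₁^{s₁} ⋯ k_r^{s_r})`. -/
def mhs (n r : ℕ) (s : Fin r → ℕ) : ℚ :=
  ∑ k ∈ Finset.univ.filter (fun k : Fin r → Fin n => ∀ i j : Fin r, i < j → k i < k j),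
    ∏ i, (1 : ℚ) / ((k i : ℕ) + 1 : ℚ) ^ s i

open Finset in
/-- `esymH n r` is the `r`-th elementary symmetric function of `1, 1/2, …, 1/n`. -/
noncomputable def esymH (n r : ℕ) : ℚ :=
  ∑ S ∈ (Finset.range n).powersetCard r, ∏ i ∈ S, (1 / ((i : ℚ) + 1))

theorem mhs_eq_esymH (n r : ℕ) : mhs n r (fun _ => 1) = esymH n r := by
  classical
  unfold mhs esymH
  have h1 : ∑ S ∈ (Finset.range n).powersetCard r, ∏ i ∈ S, (1 / ((i : ℚ) + 1))
      = ∑ S ∈ (Finset.univ : Finset (Fin n)).powersetCard r,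
          ∏ i ∈ S, (1 / (((i : ℕ) : ℚ) + 1)) := by
    have : Finset.range n = (Finset.univ : Finset (Fin n)).map Fin.valEmbedding := by
      ext i; simp
    rw [this, Finset.powersetCard_map, Finset.sum_map]
    refine Finset.sum_congr rfl fun S _ => ?_
    simp [Finset.mapEmbedding]
  rw [h1]
  refine Finset.sum_bij' (fun k _ => Finset.univ.image k)
    (fun S hS => (S.orderEmbOfFin (Finset.mem_powersetCard.1 hS).2 : Fin r → Fin n)) ?_ ?_ ?_ ?_ ?_
  · intro k hk
    have hk' : StrictMono k := fun i j hij => (Finset.mem_filter.1 hk).2 i j hij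
    simp [Finset.mem_powersetCard, Finset.card_image_of_injective _ hk'.injective]
  · intro S hS
    simp
  · intro k hk
    have hk' : StrictMono k := fun i j hij => (Finset.mem_filter.1 hk).2 i j hij
    symm
    apply Finset.orderEmbOfFin_unique
    · intro x; simp
    · exact hk'
  · intro S hS
    apply Finset.coe_injective
    simp
  · intro k hk
    have hk' : StrictMono k := fun i j hij => (Finset.mem_filter.1 hk).2 i j hij
    rw [Finset.prod_image (fun a _ b _ h => hk'.injective h)]
    simp

theorem esymH_zero (n : ℕ) : esymH n 0 = 1 := by simp [esymH]

theorem esymH_zero_succ (r : ℕ) : esymH 0 (r + 1) = 0 := by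
  unfold esymH
  rw [Finset.powersetCard_eq_empty.2 (by simp)]
  simp

theorem esymH_succ (n r : ℕ) :
    esymH (n + 1) (r + 1) = esymH n (r + 1) + esymH n r / ((n : ℚ) + 1) := by
  unfold esymH
  rw [Finset.range_add_one, Finset.powersetCard_succ_insert (by simp), Finset.sum_union,
    Finset.sum_image]
  · congr 1
    rw [Finset.sum_div]
    refine Finset.sum_congr rfl fun S hS => ?_
    have hn : n ∉ S := fun h => by
      have := (Finset.mem_powersetCard.1 hS).1 h
      simp at this
    rw [Finset.prod_insert hn]
    ring
  · intro S hS T hT h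
    have hn : ∀ S ∈ (Finset.range n).powersetCard r, n ∉ S := fun S hS h => by
      have := (Finset.mem_powersetCard.1 hS).1 h
      simp at this
    have := congrArg (fun U => U.erase n) h
    simpa [Finset.erase_insert (hn S hS), Finset.erase_insert (hn T hT)] using this
  · rw [Finset.disjoint_left]
    intro S hS hS'
    obtain ⟨T, hT, rfl⟩ := Finset.mem_image.1 hS'
    have := (Finset.mem_powersetCard.1 hS).1 (Finset.mem_insert_self n T)
    simp at this

/-- `numA n r = n! * esymH n r`, by its recursion. -/
def numA : ℕ → ℕ → ℕ
  | 0, 0 => 1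
  | 0, _ + 1 => 0
  | n + 1, 0 => (n + 1) * numA n 0
  | n + 1, r + 1 => (n + 1) * numA n (r + 1) + numA n r

theorem numA_eq (n r : ℕ) : (numA n r : ℚ) = n.factorial * esymH n r := by
  induction n generalizing r with
  | zero =>
    cases r with
    | zero => simp [numA, esymH_zero]
    | succ r => simp [numA, esymH_zero_succ]
  | succ n ih =>
    cases r with
    | zero =>
      have := ih 0
      rw [esymH_zero] at *
      simp [numA, this, Nat.factorial_succ]
    | succ r =>
      rw [esymH_succ, numA]
      push_cast [ih, Nat.factorial_succ]
      field_simp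

theorem numA_pos {n r : ℕ} (h : r ≤ n) : 0 < numA n r := by
  induction n generalizing r with
  | zero => obtain rfl : r = 0 := by omega
            simp [numA]
  | succ n ih =>
    cases r with
    | zero => have := ih (Nat.zero_le n); simp [numA, this]
    | succ r => have := ih (Nat.le_of_succ_le_succ h); simp only [numA]; omega

theorem numA_eq_zero {n r : ℕ} (h : n < r) : numA n r = 0 := by
  induction n generalizing r with
  | zero => cases r with
    | zero => omega
    | succ r => rfl
  | succ n ih =>
    cases r with
    | zero => omega
    | succ r => simp [numA, ih (show n < r by omega), ih (show n < r + 1 by omega)]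

theorem numA_self (n : ℕ) : numA n n = 1 := by
  induction n with
  | zero => rfl
  | succ n ih => simp [numA, ih, numA_eq_zero]

theorem numA_le (n r : ℕ) : numA n r ≤ (n + 1).factorial := by
  induction n generalizing r with
  | zero => cases r <;> simp [numA]
  | succ n ih =>
    cases r with
    | zero =>
      have := Nat.mul_le_mul_left (n + 1) (ih 0)
      rw [numA, Nat.factorial_succ (n + 1)]
      refine this.trans (Nat.mul_le_mul_right _ (by omega))
    | succ r =>
      have h1 := Nat.mul_le_mul_left (n + 1) (ih (r + 1))
      have h2 := ih r
      rw [numA, Nat.factorial_succ (n + 1)]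
      calc _ ≤ (n + 1) * (n + 1).factorial + (n + 1).factorial := by omega
        _ = _ := by ring

theorem esymH_pos {n r : ℕ} (h : r ≤ n) : 0 < esymH n r := by
  have h1 := numA_eq n r
  have h2 := numA_pos h
  have h3 : (0 : ℚ) < numA n r := by exact_mod_cast h2
  rw [h1] at h3
  exact pos_of_mul_pos_right h3 (by positivity)

theorem esymH_nonneg (n r : ℕ) : 0 ≤ esymH n r := by
  unfold esymH
  positivity

/-- integrality gives divisibility of `numA` -/
theorem factorial_dvd_numA {n r : ℕ} {m : ℤ} (h : esymH n r = m) : n.factorial ∣ numA n r := by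
  have h1 := numA_eq n r
  rw [h] at h1
  have h2 : (numA n r : ℤ) = n.factorial * m := by exact_mod_cast h1
  exact Int.natCast_dvd_natCast.1 ⟨m, h2⟩

section padic

variable {p : ℕ} [hp : Fact p.Prime]

theorem padic_inv_le {n : ℕ} (hn : n + 1 < p ^ 2) : padicNorm p (((n : ℚ) + 1)⁻¹) ≤ p := by
  have hp0 : (0 : ℚ) < p := by exact_mod_cast hp.out.pos
  have h1 : ¬ ((p ^ 2 : ℕ) : ℤ) ∣ ((n + 1 : ℕ) : ℤ) := by
    intro h
    have := Nat.le_of_dvd (by omega) (Int.natCast_dvd_natCast.1 h)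
    omega
  have h3 : padicValNat p (n + 1) ≤ 1 := by
    by_contra h
    push Not at h
    have h4 : p ^ 2 ∣ n + 1 := (pow_dvd_pow p h).trans pow_padicValNat_dvd
    exact h1 (Int.natCast_dvd_natCast.2 h4)
  have hne : ((n : ℚ) + 1) ≠ 0 := by positivity
  rw [padicNorm.eq_zpow_of_nonzero (inv_ne_zero hne), padicValRat.inv]
  have : padicValRat p ((n : ℚ) + 1) = padicValNat p (n + 1) := by
    rw [← padicValRat.of_nat]; push_cast; rfl
  rw [this, neg_neg]
  calc (p : ℚ) ^ ((padicValNat p (n + 1) : ℕ) : ℤ) = (p : ℚ) ^ (padicValNat p (n + 1)) := by simp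
    _ ≤ (p : ℚ) ^ 1 := pow_le_pow_right₀ (by exact_mod_cast hp.out.one_lt.le) h3
    _ = p := by simp

theorem padic_inv_eq_one {n : ℕ} (hn : ¬ p ∣ n + 1) : padicNorm p (((n : ℚ) + 1)⁻¹) = 1 := by
  have h : padicNorm p ((n + 1 : ℕ) : ℚ) = 1 := padicNorm.nat_eq_one_iff _ |>.2 hn
  push_cast at h
  have hne : ((n : ℚ) + 1) ≠ 0 := by positivity
  have h2 : padicNorm p (((n : ℚ) + 1) * ((n : ℚ) + 1)⁻¹) = 1 := by
    rw [mul_inv_cancel₀ hne]; simp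
  rw [padicNorm.mul, h, one_mul] at h2
  exact h2

theorem padic_esymH_le (n r : ℕ) (hn : n < p ^ 2) : padicNorm p (esymH n r) ≤ (p : ℚ) ^ r := by
  have hp1 : (1 : ℚ) ≤ p := by exact_mod_cast hp.out.one_lt.le
  induction n generalizing r with
  | zero =>
    cases r with
    | zero => simp [esymH_zero]
    | succ r => simp [esymH_zero_succ]
  | succ n ih =>
    cases r with
    | zero => simp [esymH_zero]
    | succ r =>
      rw [esymH_succ]
      refine padicNorm.nonarchimedean.trans (max_le (ih _ (by omega)) ?_)
      rw [div_eq_mul_inv, padicNorm.mul, pow_succ]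
      exact mul_le_mul (ih r (by omega)) (padic_inv_le hn) (padicNorm.nonneg _) (by positivity)

theorem padic_diff_le (n r : ℕ) (hn : n < p ^ 2) :
    padicNorm p (esymH n (r + 1) - esymH (n / p) (r + 1) / (p : ℚ) ^ (r + 1)) ≤ (p : ℚ) ^ r := by
  have hp1 : (1 : ℚ) ≤ p := by exact_mod_cast hp.out.one_lt.le
  have hp0 : (p : ℚ) ≠ 0 := by positivity
  induction n generalizing r with
  | zero => simp [esymH_zero_succ]
  | succ n ih =>
    have ih := fun r => ih r (by omega)
    by_cases hd : p ∣ n + 1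
    · have hdiv : (n + 1) / p = n / p + 1 := by
        rw [Nat.succ_div]; simp [hd]
      have hval : ((n : ℚ) + 1) = p * (((n / p : ℕ) : ℚ) + 1) := by
        obtain ⟨c, hc⟩ := hd
        have : c = n / p + 1 := by
          rw [← hdiv, hc, Nat.mul_div_cancel_left _ hp.out.pos]
        rw [this] at hc
        exact_mod_cast hc
      rw [hdiv, esymH_succ, esymH_succ]
      have key : esymH n (r + 1) + esymH n r / ((n : ℚ) + 1) -
          (esymH (n / p) (r + 1) + esymH (n / p) r / (((n / p : ℕ) : ℚ) + 1)) / (p : ℚ) ^ (r + 1)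
          = (esymH n (r + 1) - esymH (n / p) (r + 1) / (p : ℚ) ^ (r + 1)) +
            (esymH n r - esymH (n / p) r / (p : ℚ) ^ r) * ((n : ℚ) + 1)⁻¹ := by
        rw [hval]
        field_simp
        ring
      rw [key]
      refine padicNorm.nonarchimedean.trans (max_le (ih r) ?_)
      cases r with
      | zero => simp [esymH_zero]
      | succ r =>
        rw [padicNorm.mul]
        refine le_of_le_of_eq ?_ (pow_succ (p : ℚ) r).symm
        exact mul_le_mul (ih r) (padic_inv_le hn) (padicNorm.nonneg _) (by positivity)
    · have hdiv : (n + 1) / p = n / p := by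
        rw [Nat.succ_div]; simp [hd]
      rw [hdiv, esymH_succ]
      have key : esymH n (r + 1) + esymH n r / ((n : ℚ) + 1) -
          esymH (n / p) (r + 1) / (p : ℚ) ^ (r + 1)
          = (esymH n (r + 1) - esymH (n / p) (r + 1) / (p : ℚ) ^ (r + 1)) +
            esymH n r * ((n : ℚ) + 1)⁻¹ := by
        ring
      rw [key]
      refine padicNorm.nonarchimedean.trans (max_le (ih r) ?_)
      rw [padicNorm.mul, padic_inv_eq_one hd, mul_one]
      exact padic_esymH_le n r (by omega)

end padic

/-- The main divisibility criterion. -/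
theorem prime_dvd_numA {n r p N : ℕ} {m : ℤ} (hp : p.Prime) (hr : 1 ≤ r)
    (h : esymH n r = m) (hN : N < p) (h1 : N * p ≤ n) (h2 : n < (N + 1) * p) :
    p ∣ numA N r := by
  have : Fact p.Prime := ⟨hp⟩
  have hdiv : n / p = N := Nat.div_eq_of_lt_le h1 h2
  have hn : n < p ^ 2 := by nlinarith
  obtain ⟨r, rfl⟩ : ∃ s, r = s + 1 := ⟨r - 1, by omega⟩
  have hp1 : (1 : ℚ) ≤ p := by exact_mod_cast hp.one_lt.le
  have hp0 : (p : ℚ) ≠ 0 := by positivity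
  have hd := padic_diff_le (p := p) n r hn
  rw [hdiv, h] at hd
  have h3 : padicNorm p (esymH N (r + 1) / (p : ℚ) ^ (r + 1)) ≤ (p : ℚ) ^ r := by
    have : esymH N (r + 1) / (p : ℚ) ^ (r + 1)
        = (m : ℚ) - ((m : ℚ) - esymH N (r + 1) / (p : ℚ) ^ (r + 1)) := by ring
    rw [this]
    refine padicNorm.sub.trans (max_le ?_ hd)
    exact (padicNorm.of_int m).trans (one_le_pow₀ hp1)
  have h4 : padicNorm p (esymH N (r + 1)) ≤ (p : ℚ)⁻¹ := by
    have e : esymH N (r + 1) = (esymH N (r + 1) / (p : ℚ) ^ (r + 1)) * (p : ℚ) ^ (r + 1) := by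
      field_simp
    have e2 : padicNorm p ((p : ℚ) ^ (r + 1)) = ((p : ℚ) ^ (r + 1))⁻¹ := by
      rw [IsAbsoluteValue.abv_pow (padicNorm p), padicNorm.padicNorm_p_of_prime, inv_pow]
    rw [e, padicNorm.mul, e2]
    calc _ ≤ (p : ℚ) ^ r * ((p : ℚ) ^ (r + 1))⁻¹ :=
          mul_le_mul_of_nonneg_right h3 (by positivity)
      _ = (p : ℚ)⁻¹ := by rw [pow_succ]; field_simp
  have h5 : padicNorm p ((numA N (r + 1) : ℤ) : ℚ) ≤ (p : ℚ) ^ (-((1 : ℕ) : ℤ)) := by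
    have : ((numA N (r + 1) : ℤ) : ℚ) = N.factorial * esymH N (r + 1) := by
      rw [← numA_eq]; simp
    rw [this, padicNorm.mul]
    have h6 : padicNorm p (N.factorial : ℚ) ≤ 1 := padicNorm.of_nat _
    calc _ ≤ 1 * (p : ℚ)⁻¹ := mul_le_mul h6 h4 (padicNorm.nonneg _) zero_le_one
      _ = _ := by simp
  have h7 := padicNorm.dvd_iff_norm_le.2 h5
  rw [pow_one] at h7
  exact Int.natCast_dvd_natCast.1 h7

theorem esymH_one (n : ℕ) : esymH n 1 = harmonic n := by
  induction n with
  | zero => simp [esymH_zero_succ]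
  | succ n ih =>
    rw [esymH_succ, ih, esymH_zero, harmonic_succ]
    push_cast
    ring

theorem esymH_le_pow (n r : ℕ) : r.factorial * esymH n r ≤ harmonic n ^ r := by
  induction n generalizing r with
  | zero =>
    cases r with
    | zero => simp [esymH_zero]
    | succ r => simp [esymH_zero_succ]
  | succ n ih =>
    cases r with
    | zero => simp [esymH_zero]
    | succ r =>
      have hh : (0 : ℚ) ≤ harmonic n := by
        rw [← esymH_one]; exact esymH_nonneg n 1
      have h1 := ih (r + 1)
      have h2 := ih r
      rw [esymH_succ, harmonic_succ]
      have hx : (0 : ℚ) ≤ ((n + 1 : ℕ) : ℚ)⁻¹ := by positivity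
      set x : ℚ := ((n + 1 : ℕ) : ℚ)⁻¹ with hxdef
      have hb : harmonic n ^ (r + 1) + (r + 1) * harmonic n ^ r * x ≤ (harmonic n + x) ^ (r + 1) := by
        clear h1 h2 ih
        induction r with
        | zero => simp
        | succ r ih =>
          have hpow : (0 : ℚ) ≤ harmonic n ^ r := by positivity
          calc _ ≤ (harmonic n ^ (r + 1) + (r + 1) * harmonic n ^ r * x) * (harmonic n + x) := by
                have : (0 : ℚ) ≤ (r + 1) * harmonic n ^ r * x * x := by positivity
                have e : (harmonic n ^ (r + 1) + (r + 1) * harmonic n ^ r * x) * (harmonic n + x)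
                    = harmonic n ^ (r + 1 + 1) + ((r : ℚ) + 1 + 1) * harmonic n ^ (r + 1) * x
                      + (r + 1) * harmonic n ^ r * x * x := by ring
                rw [e]
                push_cast
                linarith
            _ ≤ (harmonic n + x) ^ (r + 1) * (harmonic n + x) :=
                mul_le_mul_of_nonneg_right ih (by positivity)
            _ = _ := by ring
      refine le_trans ?_ hb
      have e : esymH n r / ((n : ℚ) + 1) = esymH n r * x := by
        rw [hxdef]; push_cast; rw [div_eq_mul_inv]
      rw [e, mul_add]
      refine add_le_add h1 ?_
      rw [Nat.factorial_succ]
      push_cast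
      have : ((r : ℚ) + 1) * x * (r.factorial * esymH n r) ≤ ((r : ℚ) + 1) * x * harmonic n ^ r :=
        mul_le_mul_of_nonneg_left h2 (by positivity)
      nlinarith [this]

/-- If `esymH n r` is an integer then `r! ≤ (1 + log n)^r`. -/
theorem factorial_le_of_int {n r : ℕ} {m : ℤ} (hrn : r ≤ n) (h : esymH n r = m) :
    (r.factorial : ℝ) ≤ (1 + Real.log n) ^ r := by
  have h1 : (1 : ℚ) ≤ esymH n r := by
    have h2 := esymH_pos hrn
    rw [h] at h2 ⊢
    have : 0 < m := by exact_mod_cast h2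
    exact_mod_cast this
  have h2 := esymH_le_pow n r
  have hf : (0 : ℚ) ≤ r.factorial := by positivity
  have h3 : (r.factorial : ℚ) ≤ harmonic n ^ r := by nlinarith
  have h4 : (r.factorial : ℝ) ≤ (harmonic n : ℝ) ^ r := by exact_mod_cast h3
  refine h4.trans (pow_le_pow_left₀ ?_ (harmonic_le_one_add_log n) r)
  have : (0 : ℚ) ≤ harmonic n := by
    rw [← esymH_one]; exact esymH_nonneg n 1
  exact_mod_cast this

theorem lt_factorial_mono {h : ℝ} {s r : ℕ} (h0 : 0 ≤ h) (hs : h ≤ s)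
    (h1 : h ^ s < s.factorial) (hr : s ≤ r) : h ^ r < r.factorial := by
  induction r, hr using Nat.le_induction with
  | base => exact h1
  | succ r hr ih =>
    rw [pow_succ, Nat.factorial_succ]
    push_cast
    have hsr : (s : ℝ) ≤ r := by exact_mod_cast hr
    have hf : (0 : ℝ) < r.factorial := by positivity
    calc h ^ r * h ≤ r.factorial * h := mul_le_mul_of_nonneg_right ih.le h0
      _ < _ := by nlinarith

/-- certificate for a size bound -/
theorem bound_of_cert {s k B : ℕ} (h1 : B ^ 20 * 10 ^ (7 * k) ≤ 27182818 ^ k)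
    (h2 : (20 + k) ^ s < s.factorial * 20 ^ s) (h3 : 20 + k ≤ 20 * s)
    {n r : ℕ} {m : ℤ} (hr1 : 1 ≤ r) (hrn : r ≤ n) (h : esymH n r = m) (hsr : s ≤ r) : B < n := by
  by_contra hB
  push Not at hB
  have hn0 : 1 ≤ n := by omega
  have hf := factorial_le_of_int hrn h
  have hn1 : (1 : ℝ) ≤ n := by exact_mod_cast hn0
  have hB1 : (n : ℝ) ≤ B := by exact_mod_cast hB
  have hlog : Real.log n ≤ k / 20 := by
    have e1 : (B : ℝ) ^ 20 ≤ (2.7182818 : ℝ) ^ k := by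
      have : (B : ℝ) ^ 20 * 10 ^ (7 * k) ≤ 27182818 ^ k := by exact_mod_cast h1
      have e : (2.7182818 : ℝ) ^ k = 27182818 ^ k / 10 ^ (7 * k) := by
        rw [pow_mul, ← div_pow]; norm_num
      rw [e, le_div_iff₀ (by positivity)]
      exact this
    have e2 : (2.7182818 : ℝ) ^ k ≤ Real.exp 1 ^ k :=
      pow_le_pow_left₀ (by norm_num) (by have := Real.exp_one_gt_d9; linarith) k
    have e3 : (n : ℝ) ^ 20 ≤ Real.exp k := by
      rw [← Real.exp_one_pow]
      exact (pow_le_pow_left₀ (by linarith) hB1 20).trans (e1.trans e2)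
    have e4 := Real.log_le_log (by positivity) e3
    rw [Real.log_exp, Real.log_pow] at e4
    push_cast at e4
    linarith
  have hl0 : 0 ≤ Real.log n := Real.log_nonneg hn1
  have h4 : ((1 : ℝ) + k / 20) ^ s < s.factorial := by
    have : ((20 : ℝ) + k) ^ s < s.factorial * 20 ^ s := by exact_mod_cast h2
    have e : ((1 : ℝ) + k / 20) = (20 + k) / 20 := by ring
    rw [e, div_pow, div_lt_iff₀ (by positivity)]
    exact this
  have h5 : (1 : ℝ) + k / 20 ≤ s := by
    have : (20 : ℝ) + k ≤ 20 * s := by exact_mod_cast h3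
    linarith
  have h6 := lt_factorial_mono (by positivity) h5 h4 hsr
  have h7 : (1 + Real.log n) ^ r ≤ ((1 : ℝ) + k / 20) ^ r :=
    pow_le_pow_left₀ (by linarith) (by linarith) r
  linarith

theorem large_r {n r : ℕ} {m : ℤ} (hrn : r ≤ n) (h : esymH n r = m) (hr : 49 ≤ r) :
    4 * r ^ 4 ≤ n := by
  have hf := factorial_le_of_int hrn h
  have hr0 : (49 : ℝ) ≤ r := by exact_mod_cast hr
  have hn1 : (1 : ℝ) ≤ n := by exact_mod_cast (by omega : 1 ≤ n)
  have hl0 : 0 ≤ Real.log n := Real.log_nonneg hn1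
  have h1 := Real.pow_div_factorial_le_exp (r : ℝ) (by positivity) r
  have h2 : ((r : ℝ) / Real.exp 1) ^ r ≤ (1 + Real.log n) ^ r := by
    refine le_trans ?_ hf
    rw [div_pow, Real.exp_one_pow, div_le_iff₀ (Real.exp_pos _)]
    rw [div_le_iff₀ (by positivity)] at h1
    linarith
  have h3 : (r : ℝ) / Real.exp 1 ≤ 1 + Real.log n :=
    le_of_pow_le_pow_left₀ (by omega) (by linarith) h2
  have hinv : (0.36787 : ℝ) * r ≤ r / Real.exp 1 := by
    rw [le_div_iff₀ (Real.exp_pos _)]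
    have := Real.exp_one_lt_d9
    have h5 : 0.36787 * Real.exp 1 ≤ 1 := by linarith
    nlinarith
  have h17 : Real.log (4 * 49 ^ 4) ≤ 17 := by
    rw [Real.log_le_iff_le_exp (by norm_num)]
    have e : Real.exp 17 = Real.exp 1 ^ 17 := by rw [Real.exp_one_pow]; norm_num
    rw [e]
    have : (2.7182818 : ℝ) ^ 17 ≤ Real.exp 1 ^ 17 :=
      pow_le_pow_left₀ (by norm_num) (by have := Real.exp_one_gt_d9; linarith) 17
    refine le_trans ?_ this
    norm_num
  have h6 : Real.log (4 * (r : ℝ) ^ 4) ≤ Real.log n := by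
    have e : (4 * (r : ℝ) ^ 4) = (4 * 49 ^ 4) * ((r / 49) ^ 4) := by ring
    rw [e, Real.log_mul (by norm_num) (by positivity), Real.log_pow]
    have := Real.log_le_sub_one_of_pos (show (0 : ℝ) < r / 49 by positivity)
    push_cast
    generalize Real.log (4 * 49 ^ 4) = L at *
    linarith
  have h7 := (Real.log_le_log_iff (by positivity) (by positivity)).1 h6
  exact_mod_cast h7

open Chebyshev in
theorem theta_diff_le {n r : ℕ} {m : ℤ} (hr : 2 ≤ r) (h : esymH n r = m)
    (hx : 4 * r ^ 3 ≤ n / r) :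
    θ ((n / r : ℕ) : ℝ) - θ ((n / r / 3 : ℕ) : ℝ) ≤ 6 * (r : ℝ) ^ 2 * Real.log (3 * r) := by
  classical
  set x := n / r with hxdef
  have hrpos : 0 < r := by omega
  -- the primes in question
  set P := (Finset.Ioc (x / 3) x).filter Nat.Prime with hP
  set Q := ∏ N ∈ Finset.Ico r (3 * r), numA N r with hQ
  have hdvd : ∀ p ∈ P, p ∣ Q := by
    intro p hp
    obtain ⟨hp1, hpp⟩ := Finset.mem_filter.1 hp
    obtain ⟨hpl, hpu⟩ := Finset.mem_Ioc.1 hp1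
    have hN1 : r ≤ n / p := by
      rw [Nat.le_div_iff_mul_le hpp.pos, mul_comm]
      calc p * r ≤ x * r := Nat.mul_le_mul_right _ hpu
        _ ≤ n := Nat.div_mul_le_self n r
    have hN2 : n / p < 3 * r := by
      rw [Nat.div_lt_iff_lt_mul hpp.pos]
      have h1 : n < (x + 1) * r := by
        have := Nat.lt_div_mul_add (a := n) hrpos
        rw [← hxdef] at this
        linarith
      have h2 : x + 1 ≤ 3 * p := by omega
      calc n < (x + 1) * r := h1
        _ ≤ 3 * p * r := Nat.mul_le_mul_right _ h2
        _ = 3 * r * p := by ring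
    have hN3 : n / p < p := by
      have : 9 * r ≤ 4 * r ^ 3 := by nlinarith [Nat.mul_le_mul hr hr]
      omega
    have h3 : p ∣ numA (n / p) r :=
      prime_dvd_numA hpp (by omega) h hN3 (Nat.div_mul_le_self n p)
        (by have := Nat.lt_div_mul_add (a := n) hpp.pos; linarith)
    exact h3.trans (Finset.dvd_prod_of_mem _ (Finset.mem_Ico.2 ⟨hN1, hN2⟩))
  have hprod : ∏ p ∈ P, p ∣ Q :=
    Finset.prod_primes_dvd Q (fun p hp => (Finset.mem_filter.1 hp).2.prime) hdvd
  have hQpos : 0 < Q := Finset.prod_pos fun N hN => numA_pos (Finset.mem_Ico.1 hN).1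
  have hQle : Q ≤ (3 * r) ^ (6 * r ^ 2) := by
    calc Q ≤ ∏ N ∈ Finset.Ico r (3 * r), (3 * r) ^ (3 * r) := by
          refine Finset.prod_le_prod' fun N hN => ?_
          have hN := (Finset.mem_Ico.1 hN).2
          exact (numA_le N r).trans ((Nat.factorial_le hN).trans (Nat.factorial_le_pow _))
      _ = (3 * r) ^ (6 * r ^ 2) := by
          rw [Finset.prod_const, Nat.card_Ico, ← pow_mul]
          congr 1
          have : 3 * r - r = 2 * r := by omega
          rw [this]; ring
  have hle : ∏ p ∈ P, p ≤ (3 * r) ^ (6 * r ^ 2) := (Nat.le_of_dvd hQpos hprod).trans hQle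
  have hth : θ (x : ℝ) - θ ((x / 3 : ℕ) : ℝ) = ∑ p ∈ P, Real.log p := by
    unfold Chebyshev.theta
    rw [Nat.floor_natCast, Nat.floor_natCast, sub_eq_iff_eq_add, add_comm, hP, 
      ← Finset.sum_union]
    · congr 1
      rw [← Finset.filter_union, Finset.Ioc_union_Ioc_eq_Ioc (by omega) (by omega)]
    · refine Finset.disjoint_filter_filter ?_
      rw [Finset.disjoint_left]
      intro a ha hb
      have := (Finset.mem_Ioc.1 ha).2
      have := (Finset.mem_Ioc.1 hb).1
      omega
  rw [hth, ← Real.log_prod (fun p hp => by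
    have := (Finset.mem_filter.1 hp).2.pos
    positivity)]
  have hle' : (∏ p ∈ P, (p : ℝ)) ≤ (3 * r : ℝ) ^ (6 * r ^ 2) := by
    have := (Nat.cast_le (α := ℝ)).2 hle
    rw [Nat.cast_prod] at this
    push_cast at this
    exact this
  have hpos' : 0 < (∏ p ∈ P, (p : ℝ)) :=
    Finset.prod_pos fun p hp => Nat.cast_pos.2 (Finset.mem_filter.1 hp).2.pos
  calc _ ≤ Real.log ((3 * r : ℝ) ^ (6 * r ^ 2)) := Real.log_le_log hpos' hle'
    _ = _ := by rw [Real.log_pow]; push_cast; ring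

theorem real_ineq {x r : ℝ} (hx : 450000 ≤ x) (hr : 1 ≤ r) (hxr : 4 * r ^ 3 ≤ x) :
    6 * r ^ 2 * Real.log (3 * r) + Real.log (x + 1) + 2 * √x * Real.log x
      < x * Real.log 2 - Real.log 4 * (x / 3) := by
  have hx0 : 0 < x := by linarith
  obtain ⟨t, ht0, rfl⟩ : ∃ t : ℝ, 0 < t ∧ t ^ 12 = x := by
    refine ⟨x ^ ((1 : ℝ) / 12), by positivity, ?_⟩
    rw [← Real.rpow_natCast, ← Real.rpow_mul hx0.le]
    norm_num
  have ht : (2.95 : ℝ) ≤ t := by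
    by_contra hlt
    push Not at hlt
    have := pow_lt_pow_left₀ hlt ht0.le (n := 12) (by norm_num)
    norm_num at this
    linarith
  have hlogt : Real.log t ≤ 0.3679 * t := by
    have h1 := Real.log_le_sub_one_of_pos (show 0 < t / Real.exp 1 by positivity)
    rw [Real.log_div ht0.ne' (Real.exp_pos 1).ne', Real.log_exp] at h1
    have h2 : t / Real.exp 1 ≤ 0.3679 * t := by
      rw [div_le_iff₀ (Real.exp_pos _)]
      have := Real.exp_one_gt_d9
      have h5 : 1 ≤ 0.3679 * Real.exp 1 := by linarith
      nlinarith
    linarith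
  have hsqrt : √(t ^ 12) = t ^ 6 := by
    rw [show t ^ 12 = (t ^ 6) ^ 2 by ring]
    exact Real.sqrt_sq (by positivity)
  have hr63 : r ≤ 0.63 * t ^ 4 := by
    by_contra hlt
    push Not at hlt
    have := pow_lt_pow_left₀ hlt (by positivity) (n := 3) (by norm_num)
    have e : (0.63 * t ^ 4) ^ 3 = 0.63 ^ 3 * t ^ 12 := by ring
    rw [e] at this
    have : 0 < t ^ 12 := by positivity
    norm_num at *
    nlinarith
  have hl2 := Real.log_two_lt_d9
  have hl2' := Real.log_two_gt_d9
  have hl4 : Real.log 4 = 2 * Real.log 2 := by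
    rw [show (4 : ℝ) = 2 ^ 2 by norm_num, Real.log_pow]; norm_num
  have hlog3r : Real.log (3 * r) ≤ 0.6932 + 1.4716 * t := by
    have h1 : Real.log (3 * r) ≤ Real.log (2 * t ^ 4) :=
      Real.log_le_log (by positivity) (by nlinarith [pow_pos ht0 4])
    rw [Real.log_mul (x := 2) (by norm_num) (by positivity), Real.log_pow] at h1
    push_cast at h1
    linarith
  have hlogx : Real.log (t ^ 12) ≤ 4.4148 * t := by
    rw [Real.log_pow]; push_cast; linarith
  have hlogx1 : Real.log (t ^ 12 + 1) ≤ 0.6932 + 4.4148 * t := by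
    have h1 : Real.log (t ^ 12 + 1) ≤ Real.log (2 * t ^ 12) :=
      Real.log_le_log (by positivity) (by linarith)
    rw [Real.log_mul (by norm_num) (by positivity)] at h1
    linarith
  have hr2 : r ^ 2 ≤ 0.3969 * t ^ 8 := by
    calc r ^ 2 ≤ (0.63 * t ^ 4) ^ 2 := pow_le_pow_left₀ (by linarith) hr63 2
      _ = _ := by ring
  have b1 : 6 * r ^ 2 * Real.log (3 * r) ≤ 6 * (0.3969 * t ^ 8) * (0.6932 + 1.4716 * t) := by
    have : 0 ≤ Real.log (3 * r) := Real.log_nonneg (by linarith)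
    gcongr
  have b2 : 2 * t ^ 6 * Real.log (t ^ 12) ≤ 2 * t ^ 6 * (4.4148 * t) := by gcongr
  rw [hsqrt, hl4]
  have b3 : t ^ 12 * 0.231 ≤ t ^ 12 * Real.log 2 - 2 * Real.log 2 * (t ^ 12 / 3) := by
    have : 0 < t ^ 12 := by positivity
    nlinarith
  have p1 : 0 < t ^ 7 := by positivity
  have p2 : 2.95 * t ^ 7 ≤ t ^ 8 := by
    rw [pow_succ t 7]; nlinarith
  have p3 : 2.95 * t ^ 8 ≤ t ^ 9 := by
    rw [pow_succ t 8]; nlinarith [pow_pos ht0 8]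
  have p4 : 25.6 * t ^ 9 ≤ t ^ 12 := by
    have h3 : (25.6 : ℝ) ≤ t ^ 3 := by
      calc (25.6 : ℝ) ≤ 2.95 ^ 3 := by norm_num
        _ ≤ t ^ 3 := pow_le_pow_left₀ (by norm_num) ht 3
    rw [show t ^ 12 = t ^ 3 * t ^ 9 by ring]
    exact mul_le_mul_of_nonneg_right h3 (by positivity)
  have p5 : 600 * t ≤ t ^ 7 := by
    have h3 : (600 : ℝ) ≤ t ^ 6 := by
      calc (600 : ℝ) ≤ 2.95 ^ 6 := by norm_num
        _ ≤ t ^ 6 := pow_le_pow_left₀ (by norm_num) ht 6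
    rw [pow_succ t 6]
    exact mul_le_mul_of_nonneg_right h3 ht0.le
  have e1 : 6 * (0.3969 * t ^ 8) * (0.6932 + 1.4716 * t)
      = 6 * 0.3969 * 0.6932 * t ^ 8 + 6 * 0.3969 * 1.4716 * t ^ 9 := by ring
  have e2 : 2 * t ^ 6 * (4.4148 * t) = 8.8296 * t ^ 7 := by ring
  rw [e1] at b1
  rw [e2] at b2
  linarith

theorem not_int_large {n r : ℕ} {m : ℤ} (hr : 2 ≤ r) (hx : 4 * r ^ 3 ≤ n / r)
    (hx2 : 450000 ≤ n / r) : esymH n r ≠ m := by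
  intro h
  have h1 := theta_diff_le hr h hx
  have h2 := Chebyshev.theta_ge (n / r)
  have h3 := Chebyshev.theta_le_log4_mul_x (x := ((n / r / 3 : ℕ) : ℝ)) (by positivity)
  have h4 : ((n / r / 3 : ℕ) : ℝ) ≤ ((n / r : ℕ) : ℝ) / 3 := Nat.cast_div_le
  have h5 := real_ineq (x := ((n / r : ℕ) : ℝ)) (r := r) (by exact_mod_cast hx2)
    (by exact_mod_cast (by omega : 1 ≤ r)) (by exact_mod_cast hx)
  have h6 : Real.log 4 * ((n / r / 3 : ℕ) : ℝ) ≤ Real.log 4 * (((n / r : ℕ) : ℝ) / 3) :=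
    mul_le_mul_of_nonneg_left h4 (Real.log_nonneg (by norm_num))
  linarith

/-! ### Kernel computations -/

/-- Evaluate the argument before continuing. -/
def forceNat (n : ℕ) (f : ℕ → Bool) : Bool :=
  Nat.rec (motive := fun _ => Bool) (f 0) (fun k _ => f (Nat.succ k)) n

theorem forceNat_eq (n : ℕ) (f : ℕ → Bool) : forceNat n f = f n := by
  cases n <;> rfl

/-- no divisor among `2, …, s + 1` -/
def noDiv (p s : ℕ) : Bool :=
  Nat.rec (motive := fun _ => Bool) true
    (fun k ih => bif Nat.beq (p % (k + 2)) 0 then false else ih) s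

theorem noDiv_spec {p s : ℕ} (h : noDiv p s = true) : ∀ d, 2 ≤ d → d ≤ s + 1 → ¬ d ∣ p := by
  induction s with
  | zero => intro d h1 h2; omega
  | succ s ih =>
    have hd : noDiv p (s + 1)
        = bif Nat.beq (p % (s + 2)) 0 then false else noDiv p s := rfl
    rw [hd] at h
    cases hb : Nat.beq (p % (s + 2)) 0 with
    | true => simp [hb] at h
    | false =>
      rw [hb] at h
      intro d h1 h2
      by_cases hds : d ≤ s + 1
      · exact ih h d h1 hds
      · obtain rfl : d = s + 2 := by omega
        intro hdv
        rw [Nat.mod_eq_zero_of_dvd hdv] at hb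
        simp at hb

def primeTest (p : ℕ) : Bool := Nat.ble 2 p && noDiv p (Nat.sqrt p - 1)

theorem primeTest_spec {p : ℕ} (h : primeTest p = true) : p.Prime := by
  unfold primeTest at h
  rw [Bool.and_eq_true] at h
  have h2 : 2 ≤ p := Nat.le_of_ble_eq_true h.1
  by_contra hp
  have h3 := Nat.minFac_sq_le_self (by omega) hp
  have h4 : p.minFac ≤ Nat.sqrt p := by rw [Nat.le_sqrt']; exact h3
  have h5 : 2 ≤ p.minFac := (Nat.minFac_prime (by omega)).two_le
  exact noDiv_spec h.2 p.minFac h5 (by omega) (Nat.minFac_dvd p)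

/-- `[numA n j, …, numA n (j + m - 1)]`, reduced modulo `M` -/
def rowF (M n : ℕ) : ℕ → ℕ → List ℕ
  | _, 0 => []
  | j, m + 1 => numA n j % M :: rowF M n (j + 1) m

theorem rowF_length (M n j m : ℕ) : (rowF M n j m).length = m := by
  induction m generalizing j with
  | zero => rfl
  | succ m ih => simp [rowF, ih]

theorem rowF_getD (M n j m i : ℕ) (h : i < m) :
    (rowF M n j m).getD i 0 = numA n (j + i) % M := by
  induction m generalizing j i with
  | zero => omega
  | succ m ih =>
    cases i with
    | zero => simp [rowF]
    | succ i =>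
      have := ih (j + 1) i (by omega)
      simp only [rowF, List.getD_cons_succ, this]
      congr 2
      omega

def stepK (M c : ℕ) : ℕ → List ℕ → (List ℕ → Bool) → Bool
  | _, [], k => k []
  | prev, x :: xs, k =>
    forceNat ((c * x + prev) % M) fun y => stepK M c x xs fun ys => k (y :: ys)

theorem stepK_rowF_succ (M n j m : ℕ) (k : List ℕ → Bool) :
    stepK M (n + 1) (numA n j % M) (rowF M n (j + 1) m) k = k (rowF M (n + 1) (j + 1) m) := by
  induction m generalizing j k with
  | zero => rfl
  | succ m ih =>
    simp only [rowF, stepK, forceNat_eq, ih, numA]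
    congr 2
    simp [Nat.add_mod, Nat.mul_mod]

theorem stepK_rowF (M n m : ℕ) (k : List ℕ → Bool) :
    stepK M (n + 1) 0 (rowF M n 0 m) k = k (rowF M (n + 1) 0 m) := by
  cases m with
  | zero => rfl
  | succ m =>
    simp only [rowF, stepK, forceNat_eq, stepK_rowF_succ, numA]
    congr 2
    simp [Nat.mul_mod]

def iterK (M : ℕ) : ℕ → ℕ → List ℕ → (List ℕ → Bool) → Bool
  | 0, _, l, k => k l
  | f + 1, n, l, k => forceNat (n + 1) fun c => stepK M c 0 l fun l' => iterK M f c l' k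

theorem iterK_rowF (M f n m : ℕ) (k : List ℕ → Bool) :
    iterK M f n (rowF M n 0 m) k = k (rowF M (n + f) 0 m) := by
  induction f generalizing n with
  | zero => rfl
  | succ f ih =>
    simp only [iterK, forceNat_eq, stepK_rowF, ih]
    congr 2
    omega

def initRow (M : ℕ) : ℕ → List ℕ
  | 0 => []
  | m + 1 => (1 % M) :: List.replicate m 0

theorem rowF_zero (M j m : ℕ) : rowF M 0 (j + 1) m = List.replicate m 0 := by
  induction m generalizing j with
  | zero => rfl
  | succ m ih => simp [rowF, ih, numA, List.replicate_succ]

theorem initRow_eq (M m : ℕ) : initRow M m = rowF M 0 0 m := by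
  cases m with
  | zero => rfl
  | succ m => simp [initRow, rowF, rowF_zero, numA]

/-- `p` does not divide `numA N r` -/
def ndvdTest (p N r : ℕ) : Bool :=
  iterK p N 0 (initRow p (r + 1)) fun l => !(Nat.beq (l.getD r 0) 0)

theorem ndvdTest_spec {p N r : ℕ} (h : ndvdTest p N r = true) : ¬ p ∣ numA N r := by
  unfold ndvdTest at h
  rw [initRow_eq, iterK_rowF, rowF_getD _ _ _ _ _ (by omega)] at h
  intro hd
  simp only [Nat.zero_add] at h
  rw [Nat.mod_eq_zero_of_dvd hd] at h
  simp at h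

/-- test for one row: no entry with index in `[2, n]` is divisible by `G` -/
def rowTest (n G : ℕ) (l : List ℕ) : Bool :=
  Nat.beq n 3 || ((l.take (n + 1)).drop 2).all fun v => !(Nat.beq (v % G) 0)

def dpTest (M : ℕ) : ℕ → ℕ → ℕ → List ℕ → Bool
  | 0, _, _, _ => true
  | f + 1, n, G, l =>
    forceNat (n + 1) fun c => forceNat (Nat.gcd (c * G) M) fun G' =>
      stepK M c 0 l fun l' => rowTest c G' l' && dpTest M f c G' l'

theorem dpTest_spec {M f n m G : ℕ} (hG1 : G ∣ n.factorial)
    (h : dpTest M f n G (rowF M n 0 m) = true) :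
    ∀ k, n < k → k ≤ n + f →
      ∃ G', G' ∣ k.factorial ∧ G' ∣ M ∧ rowTest k G' (rowF M k 0 m) = true := by
  induction f generalizing n G with
  | zero => intro k h1 h2; omega
  | succ f ih =>
    simp only [dpTest, forceNat_eq, stepK_rowF, Bool.and_eq_true] at h
    intro k h1 h2
    have hd : Nat.gcd ((n + 1) * G) M ∣ (n + 1).factorial :=
      (Nat.gcd_dvd_left _ _).trans (by
        rw [Nat.factorial_succ]; exact Nat.mul_dvd_mul_left _ hG1)
    by_cases hk : k = n + 1
    · subst hk; exact ⟨_, hd, Nat.gcd_dvd_right _ _, h.1⟩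
    · exact ih hd h.2 k (by omega) (by omega)

theorem dp_check :
    dpTest (2 ^ 8 * 3 ^ 200) 400 0 1 (initRow (2 ^ 8 * 3 ^ 200) 17) = true := by
  decide +kernel

theorem not_int_small {n r : ℕ} {m : ℤ} (hr : 2 ≤ r) (hrn : r ≤ n) (hr2 : r ≤ 16) (hn : n ≤ 400)
    (hn3 : n ≠ 3) : esymH n r ≠ m := by
  intro h
  have h1 := dp_check
  rw [initRow_eq] at h1
  generalize 2 ^ 8 * 3 ^ 200 = M at h1
  obtain ⟨G, hG1, hG2, h2⟩ := dpTest_spec (n := 0) (by simp) h1 n (by omega) (by omega)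
  unfold rowTest at h2
  have e1 : Nat.beq n 3 = false := by
    rw [Bool.eq_false_iff]; intro hb; exact hn3 (Nat.eq_of_beq_eq_true hb)
  rw [e1, Bool.false_or, List.all_eq_true] at h2
  have hmem : numA n r % M ∈ ((rowF M n 0 17).take (n + 1)).drop 2 := by
    have hg := rowF_getD M n 0 17 r (by omega)
    rw [Nat.zero_add] at hg
    have hl := rowF_length M n 0 17
    generalize rowF M n 0 17 = l at hg hl
    rw [List.mem_iff_getElem]
    refine ⟨r - 2, by rw [List.length_drop, List.length_take, hl]; omega, ?_⟩
    rw [List.getElem_drop, List.getElem_take, ← hg,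
      List.getD_eq_getElem (hn := by rw [hl]; omega)]
    congr 1
    omega
  have h3 := h2 _ hmem
  have h5 : (numA n r % M) % G = 0 := by
    rw [Nat.mod_mod_of_dvd _ hG2]
    exact Nat.mod_eq_zero_of_dvd (hG1.trans (factorial_dvd_numA h))
  rw [h5] at h3
  simp at h3

def chainList : List ℕ := [
    1361, 1381, 1409, 1433, 1459, 1489, 1511, 1531, 1559, 1583, 1613, 1637, 1669, 1699, 1733,
    1759, 1789, 1823, 1847, 1879, 1913, 1951, 1987, 2027, 2069, 2111, 2153, 2179, 2221, 2267,
    2311, 2357, 2399, 2447, 2477, 2521, 2557, 2609, 2663, 2713, 2767, 2819, 2861, 2917, 2971,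
    3023, 3083, 3137, 3191, 3257, 3323, 3391, 3461, 3533, 3593, 3659, 3733, 3803, 3881, 3947,
    4027, 4099, 4177, 4261, 4349, 4423, 4513, 4603, 4691, 4787, 4877, 4973, 5059, 5153, 5237,
    5333, 5443, 5531, 5641, 5749, 5867, 5987, 6101, 6221, 6343, 6473, 6607, 6737, 6871, 7013,
    7159, 7307, 7459, 7607, 7759, 7919, 8081, 8243, 8389, 8563, 8741, 8923, 9103, 9283, 9473,
    9661, 9859, 10061, 10267, 10477, 10691, 10909, 11131, 11353, 11587, 11827, 12073, 12323,
    12577, 12829, 13093, 13339, 13613, 13883, 14159, 14449, 14747, 15053, 15361, 15679, 16001,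
    16333, 16673, 17011, 17359, 17713, 18077, 18451, 18803, 19183, 19577, 19979, 20393, 20809,
    21227, 21661, 22111, 22571, 23041, 23509, 23993, 24481, 24989, 25471, 25999, 26539, 27091,
    27653, 28229, 28817, 29411, 30013, 30637, 31271, 31907, 32569, 33247, 33937, 34631, 35339,
    36073, 36821, 37579, 38351, 39139, 39953, 40771, 41617, 42473, 43331, 44221, 45139, 46073,
    47017, 47981, 48973, 49993, 51031, 52081, 53161, 54251, 55381, 56533, 57709, 58909, 60133,
    61381, 62659, 63949, 65269, 66617, 67993, 69403, 70843, 72313, 73819, 75353, 76919, 78517,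
    80149, 81817, 83497, 85229, 86993, 88801, 90647, 92507, 94433, 96377, 98377, 100417, 102503,
    104623, 106801, 109013, 111271, 113567, 115931, 118343, 120779, 123289, 125821, 128437,
    131111, 133831, 136607, 139439, 142327, 145289, 148303, 151391, 154543, 157747, 161033,
    164387, 167809, 171299, 174859, 178501, 182209, 185993, 189859, 193813, 197837, 201953,
    206153, 210437, 214817, 219281, 223849, 228511, 233267, 238109, 243031, 248089, 253247,
    258521, 263899, 269393, 275003, 280729, 286553, 292517, 298607, 304813, 311153, 317621,
    324223, 330943, 337837, 344873, 352057, 359389, 366869, 374501, 382303, 390263, 398393,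
    406673, 415141, 423781, 432589, 441587, 450767]

def boundTable : List (ℕ × ℕ × ℕ) := [
    (17, 123, 468), (18, 131, 699), (19, 138, 992), (20, 146, 1480), (21, 153, 2100),
    (22, 161, 3133), (23, 168, 4447), (24, 176, 6634), (25, 183, 9414), (26, 191, 14044),
    (27, 198, 19930), (28, 205, 28282), (29, 213, 42192), (32, 235, 126753)]

def coverTable : List (ℕ × ℕ × List (ℕ × ℕ)) := [
  (2, 401, [
    (199, 2), (293, 2), (439, 2), (653, 2), (977, 2)]),
  (3, 401, [
    (131, 3), (173, 3), (229, 3), (293, 3), (389, 3), (509, 3), (677, 3), (887, 3), (1181, 3)]),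
  (4, 401, [
    (97, 4), (113, 4), (139, 4), (173, 4), (211, 4), (263, 4), (317, 4), (389, 4), (479, 4),
    (593, 4), (739, 4), (919, 4), (1129, 4)]),
  (5, 401, [
    (79, 5), (89, 5), (103, 5), (113, 5), (131, 5), (157, 5), (181, 5), (211, 5), (251, 5),
    (293, 5), (349, 5), (409, 5), (487, 5), (577, 5), (691, 5), (829, 5), (991, 5), (1187, 5)]),
  (6, 401, [
    (61, 6), (71, 6), (79, 6), (89, 6), (103, 6), (113, 6), (131, 6), (151, 6), (173, 6),
    (199, 6), (229, 6), (263, 6), (293, 6), (337, 6), (389, 6), (449, 6), (523, 6), (607, 6),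
    (701, 6), (811, 6), (941, 6), (1097, 6), (1279, 6)]),
  (7, 401, [
    (53, 7), (59, 7), (67, 7), (73, 7), (83, 7), (89, 7), (101, 7), (113, 7), (127, 7),
    (139, 7), (157, 7), (179, 7), (199, 7), (227, 7), (257, 7), (293, 7), (331, 7), (373, 7),
    (421, 7), (479, 7), (547, 7), (619, 7), (701, 7), (797, 7), (907, 7), (1033, 7), (1171, 7),
    (1327, 7)]),
  (8, 401, [
    (47, 8), (47, 9), (53, 8), (59, 8), (61, 8), (67, 8), (73, 8), (79, 8), (83, 8), (89, 8),
    (97, 8), (109, 8), (113, 8), (127, 8), (139, 8), (151, 8), (167, 8), (181, 8), (199, 8),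
    (223, 8), (241, 8), (271, 8), (293, 8), (317, 8), (353, 8), (397, 8), (443, 8), (491, 8),
    (547, 8), (613, 8), (683, 8), (761, 8), (853, 8), (953, 8), (1069, 8), (1201, 8), (1327, 8)]),
  (9, 401, [
    (43, 9), (47, 9), (47, 10), (53, 9), (53, 10), (61, 9), (67, 9), (73, 9), (79, 9), (83, 9),
    (89, 9), (97, 9), (107, 9), (113, 9), (113, 10), (137, 9), (151, 9), (167, 9), (181, 9),
    (199, 9), (211, 9), (233, 9), (257, 9), (283, 9), (313, 9), (347, 9), (383, 9), (421, 9),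
    (467, 9), (509, 9), (563, 9), (619, 9), (683, 9), (757, 9), (839, 9), (929, 9), (1031, 9),
    (1129, 9), (1249, 9)]),
  (10, 401, [
    (37, 10), (37, 11), (43, 10), (47, 10), (47, 11), (53, 10), (53, 11), (61, 10), (67, 10),
    (73, 10), (79, 10), (83, 10), (89, 10), (97, 10), (103, 10), (113, 10), (113, 11),
    (131, 10), (139, 10), (151, 10), (163, 10), (179, 10), (193, 10), (211, 10), (229, 10),
    (251, 10), (271, 10), (293, 10), (317, 10), (347, 10), (379, 10), (409, 10), (449, 10),
    (491, 10), (523, 10), (571, 10), (619, 10), (677, 10), (743, 10), (811, 10), (887, 10),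
    (971, 10), (1063, 10), (1163, 10), (1279, 10)]),
  (11, 401, [
    (23, 17), (37, 11), (37, 12), (43, 11), (43, 12), (47, 11), (47, 12), (53, 11), (53, 12),
    (61, 11), (61, 12), (71, 11), (73, 11), (79, 11), (83, 11), (89, 11), (97, 11), (103, 11),
    (109, 11), (113, 11), (113, 12), (131, 11), (139, 11), (151, 11), (163, 11), (173, 11),
    (181, 11), (197, 11), (211, 11), (229, 11), (241, 11), (257, 11), (277, 11), (293, 11),
    (317, 11), (337, 11), (367, 11), (397, 11), (433, 11), (467, 11), (509, 11), (547, 11),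
    (593, 11), (643, 11), (701, 11), (761, 11), (829, 11), (887, 11), (967, 11), (1051, 11),
    (1129, 11), (1231, 11), (1327, 11)]),
  (12, 401, [
    (31, 12), (31, 13), (31, 14), (37, 12), (37, 13), (43, 12), (43, 13), (47, 12), (47, 13),
    (53, 12), (53, 13), (61, 12), (61, 13), (71, 12), (73, 12), (79, 12), (83, 12), (89, 12),
    (89, 13), (103, 12), (109, 12), (113, 12), (113, 13), (131, 12), (139, 12), (149, 12),
    (157, 12), (167, 12), (179, 12), (193, 12), (199, 12), (211, 12), (227, 12), (241, 12),
    (257, 12), (277, 12), (293, 12), (317, 12), (337, 12), (359, 12), (383, 12), (409, 12),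
    (443, 12), (479, 12), (509, 12), (547, 12), (587, 12), (631, 12), (683, 12), (739, 12),
    (797, 12), (863, 12), (929, 12), (997, 12), (1069, 12), (1153, 12), (1249, 12), (1327, 12)]),
  (13, 401, [
    (29, 13), (31, 13), (31, 14), (31, 15), (37, 13), (37, 14), (41, 13), (43, 13), (43, 14),
    (47, 13), (47, 14), (53, 13), (53, 14), (61, 13), (61, 14), (67, 13), (71, 13), (73, 13),
    (73, 14), (83, 13), (89, 13), (89, 14), (101, 13), (107, 13), (113, 13), (113, 14),
    (127, 13), (131, 13), (139, 13), (149, 13), (157, 13), (167, 13), (179, 13), (191, 13),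
    (199, 13), (211, 13), (227, 13), (241, 13), (257, 13), (271, 13), (283, 13), (293, 13),
    (313, 13), (337, 13), (359, 13), (383, 13), (409, 13), (439, 13), (467, 13), (499, 13),
    (523, 13), (563, 13), (601, 13), (647, 13), (691, 13), (743, 13), (797, 13), (857, 13),
    (919, 13), (983, 13), (1051, 13), (1129, 13), (1213, 13), (1303, 13)]),
  (14, 401, [
    (23, 17), (29, 14), (31, 14), (31, 15), (31, 16), (37, 14), (37, 15), (41, 14), (43, 14),
    (43, 15), (47, 14), (47, 15), (53, 14), (53, 15), (59, 14), (61, 14), (61, 15), (67, 14),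
    (71, 14), (73, 14), (73, 15), (83, 14), (83, 15), (89, 14), (89, 15), (101, 14), (107, 14),
    (113, 14), (113, 15), (127, 14), (131, 14), (139, 14), (139, 15), (157, 14), (167, 14),
    (173, 14), (181, 14), (193, 14), (199, 14), (211, 14), (223, 14), (233, 14), (241, 14),
    (257, 14), (271, 14), (283, 14), (293, 14), (313, 14), (331, 14), (353, 14), (373, 14),
    (397, 14), (421, 14), (449, 14), (479, 14), (509, 14), (541, 14), (577, 14), (617, 14),
    (661, 14), (701, 14), (751, 14), (797, 14), (853, 14), (911, 14), (971, 14), (1039, 14),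
    (1109, 14), (1187, 14), (1259, 14), (1327, 14)]),
  (15, 401, [
    (23, 17), (23, 18), (29, 15), (29, 16), (31, 15), (31, 16), (31, 17), (37, 15), (37, 16),
    (41, 15), (43, 15), (43, 16), (47, 15), (47, 16), (53, 15), (53, 16), (59, 15), (61, 15),
    (61, 16), (67, 15), (71, 15), (73, 15), (73, 16), (79, 15), (83, 15), (83, 16), (89, 15),
    (89, 16), (97, 15), (103, 15), (109, 15), (113, 15), (113, 16), (127, 15), (131, 15),
    (139, 15), (139, 16), (157, 15), (167, 15), (173, 15), (181, 15), (193, 15), (199, 15),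
    (211, 15), (223, 15), (233, 15), (241, 15), (257, 15), (271, 15), (283, 15), (293, 15),
    (311, 15), (331, 15), (353, 15), (373, 15), (397, 15), (421, 15), (449, 15), (467, 15),
    (491, 15), (523, 15), (557, 15), (593, 15), (631, 15), (673, 15), (709, 15), (751, 15),
    (797, 15), (839, 15), (887, 15), (941, 15), (997, 15), (1063, 15), (1129, 15), (1201, 15),
    (1279, 15)]),
  (16, 401, [
    (23, 17), (23, 18), (23, 19), (23, 20), (29, 16), (29, 17), (31, 16), (31, 17), (31, 18),
    (31, 19), (37, 16), (37, 17), (41, 16), (43, 16), (43, 17), (47, 16), (47, 17), (47, 18),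
    (53, 16), (53, 17), (59, 16), (61, 16), (61, 17), (67, 16), (71, 16), (73, 16), (73, 17),
    (79, 16), (83, 16), (83, 17), (89, 16), (89, 17), (97, 16), (103, 16), (109, 16), (113, 16),
    (113, 17), (127, 16), (131, 16), (139, 16), (139, 17), (151, 16), (157, 16), (163, 16),
    (173, 16), (181, 16), (191, 16), (199, 16), (211, 16), (223, 16), (233, 16), (241, 16),
    (251, 16), (263, 16), (277, 16), (293, 16), (311, 16), (317, 16), (331, 16), (349, 16),
    (367, 16), (389, 16), (409, 16), (433, 16), (457, 16), (479, 16), (503, 16), (523, 16),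
    (547, 16), (577, 16), (613, 16), (647, 16), (683, 16), (719, 16), (761, 16), (797, 16),
    (839, 16), (887, 16), (941, 16), (997, 16), (1051, 16), (1109, 16), (1171, 16), (1237, 16),
    (1307, 16)]),
  (17, 469, [
    (23, 20), (23, 21), (29, 17), (29, 18), (31, 17), (31, 18), (31, 19), (31, 20), (37, 17),
    (37, 18), (41, 17), (43, 17), (43, 18), (47, 17), (47, 18), (47, 19), (53, 17), (53, 18),
    (59, 17), (61, 17), (61, 18), (67, 17), (67, 18), (73, 17), (73, 18), (79, 17), (83, 17),
    (83, 18), (89, 17), (89, 18), (97, 17), (101, 17), (103, 17), (109, 17), (113, 17),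
    (113, 18), (113, 19), (131, 17), (137, 17), (139, 17), (139, 18), (151, 17), (157, 17),
    (163, 17), (167, 17), (173, 17), (181, 17), (191, 17), (199, 17), (199, 18), (211, 17),
    (223, 17), (233, 17), (241, 17), (251, 17), (263, 17), (277, 17), (293, 17), (307, 17),
    (317, 17), (331, 17), (349, 17), (367, 17), (383, 17), (401, 17), (421, 17), (443, 17),
    (467, 17), (491, 17), (509, 17), (523, 17), (547, 17), (577, 17), (607, 17), (641, 17),
    (677, 17), (709, 17), (743, 17), (773, 17), (811, 17), (857, 17), (907, 17), (953, 17),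
    (1009, 17), (1063, 17), (1123, 17), (1187, 17), (1249, 17), (1321, 17)]),
  (18, 700, [
    (37, 18), (37, 19), (41, 18), (43, 18), (43, 19), (47, 18), (47, 19), (47, 20), (53, 18),
    (53, 19), (53, 20), (61, 18), (61, 19), (67, 18), (67, 19), (73, 18), (73, 19), (79, 18),
    (83, 18), (83, 19), (89, 18), (89, 19), (97, 18), (101, 18), (103, 18), (107, 18),
    (109, 18), (113, 18), (113, 19), (113, 20), (131, 18), (137, 18), (139, 18), (139, 19),
    (151, 18), (157, 18), (163, 18), (167, 18), (173, 18), (181, 18), (191, 18), (199, 18),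
    (199, 19), (211, 18), (211, 19), (233, 18), (241, 18), (251, 18), (263, 18), (277, 18),
    (283, 18), (293, 18), (307, 18), (317, 18), (331, 18), (349, 18), (367, 18), (383, 18),
    (401, 18), (421, 18), (443, 18), (467, 18), (491, 18), (509, 18), (523, 18), (547, 18),
    (577, 18), (607, 18), (631, 18), (661, 18), (691, 18), (727, 18), (761, 18), (797, 18),
    (839, 18), (883, 18), (929, 18), (977, 18), (1031, 18), (1087, 18), (1129, 18), (1187, 18),
    (1249, 18), (1307, 18)]),
  (19, 993, [
    (47, 21), (53, 19), (53, 20), (53, 21), (61, 19), (61, 20), (67, 19), (67, 20), (73, 19),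
    (73, 20), (79, 19), (83, 19), (83, 20), (89, 19), (89, 20), (97, 19), (101, 19), (103, 19),
    (107, 19), (109, 19), (113, 19), (113, 20), (113, 21), (127, 19), (131, 19), (137, 19),
    (139, 19), (139, 20), (151, 19), (157, 19), (163, 19), (167, 19), (173, 19), (181, 19),
    (181, 20), (199, 19), (199, 20), (211, 19), (211, 20), (233, 19), (241, 19), (251, 19),
    (263, 19), (271, 19), (283, 19), (293, 19), (307, 19), (317, 19), (331, 19), (347, 19),
    (359, 19), (373, 19), (389, 19), (409, 19), (421, 19), (443, 19), (463, 19), (487, 19),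
    (509, 19), (523, 19), (547, 19), (571, 19), (601, 19), (631, 19), (661, 19), (691, 19),
    (727, 19), (761, 19), (797, 19), (829, 19), (863, 19), (907, 19), (953, 19), (997, 19),
    (1049, 19), (1103, 19), (1153, 19), (1213, 19), (1259, 19), (1321, 19)]),
  (20, 1481, [
    (73, 20), (73, 21), (79, 20), (79, 21), (83, 20), (83, 21), (89, 20), (89, 21), (97, 20),
    (101, 20), (103, 20), (107, 20), (109, 20), (113, 20), (113, 21), (113, 22), (127, 20),
    (131, 20), (137, 20), (139, 20), (139, 21), (151, 20), (157, 20), (163, 20), (167, 20),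
    (173, 20), (181, 20), (181, 21), (199, 20), (199, 21), (211, 20), (211, 21), (229, 20),
    (239, 20), (241, 20), (251, 20), (263, 20), (271, 20), (283, 20), (293, 20), (307, 20),
    (317, 20), (331, 20), (347, 20), (359, 20), (373, 20), (389, 20), (401, 20), (421, 20),
    (439, 20), (457, 20), (479, 20), (499, 20), (523, 20), (547, 20), (571, 20), (599, 20),
    (619, 20), (647, 20), (677, 20), (709, 20), (743, 20), (773, 20), (811, 20), (839, 20),
    (877, 20), (919, 20), (953, 20), (997, 20), (1039, 20), (1087, 20), (1129, 20), (1181, 20),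
    (1237, 20), (1297, 20)]),
  (21, 2101, [
    (97, 21), (101, 21), (103, 21), (107, 21), (109, 21), (113, 21), (113, 22), (113, 23),
    (127, 21), (131, 21), (137, 21), (139, 21), (139, 22), (151, 21), (157, 21), (163, 21),
    (167, 21), (173, 21), (181, 21), (181, 22), (197, 21), (199, 21), (199, 22), (211, 21),
    (211, 22), (229, 21), (239, 21), (241, 21), (251, 21), (257, 21), (269, 21), (281, 21),
    (293, 21), (293, 22), (317, 21), (331, 21), (337, 21), (353, 21), (367, 21), (383, 21),
    (401, 21), (419, 21), (433, 21), (449, 21), (467, 21), (487, 21), (509, 21), (523, 21),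
    (547, 21), (571, 21), (593, 21), (619, 21), (647, 21), (677, 21), (709, 21), (739, 21),
    (773, 21), (809, 21), (839, 21), (877, 21), (911, 21), (953, 21), (997, 21), (1039, 21),
    (1087, 21), (1129, 21), (1181, 21), (1237, 21), (1291, 21), (1327, 21)]),
  (22, 3134, [
    (139, 22), (139, 23), (151, 22), (157, 22), (163, 22), (167, 22), (173, 22), (179, 22),
    (181, 22), (181, 23), (197, 22), (199, 22), (199, 23), (211, 22), (211, 23), (229, 22),
    (239, 22), (241, 22), (251, 22), (257, 22), (263, 22), (271, 22), (283, 22), (293, 22),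
    (293, 23), (317, 22), (331, 22), (337, 22), (349, 22), (359, 22), (373, 22), (389, 22),
    (401, 22), (419, 22), (433, 22), (449, 22), (467, 22), (487, 22), (509, 22), (523, 22),
    (541, 22), (563, 22), (587, 22), (613, 22), (631, 22), (659, 22), (683, 22), (709, 22),
    (739, 22), (769, 22), (797, 22), (829, 22), (863, 22), (887, 22), (919, 22), (953, 22),
    (991, 22), (1033, 22), (1069, 22), (1117, 22), (1163, 22), (1213, 22), (1259, 22),
    (1307, 22)]),
  (23, 4448, [
    (193, 23), (199, 23), (199, 24), (211, 23), (211, 24), (229, 23), (233, 23), (241, 23),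
    (251, 23), (257, 23), (263, 23), (271, 23), (281, 23), (293, 23), (293, 24), (317, 23),
    (317, 24), (337, 23), (349, 23), (359, 23), (373, 23), (389, 23), (401, 23), (409, 23),
    (421, 23), (439, 23), (457, 23), (467, 23), (487, 23), (503, 23), (523, 23), (541, 23),
    (563, 23), (587, 23), (607, 23), (631, 23), (653, 23), (677, 23), (701, 23), (727, 23),
    (757, 23), (787, 23), (821, 23), (853, 23), (887, 23), (919, 23), (953, 23), (991, 23),
    (1033, 23), (1069, 23), (1109, 23), (1153, 23), (1201, 23), (1249, 23), (1303, 23),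
    (1327, 23)]),
  (24, 6635, [
    (271, 24), (281, 24), (283, 24), (293, 24), (293, 25), (317, 24), (317, 25), (337, 24),
    (349, 24), (359, 24), (373, 24), (383, 24), (397, 24), (409, 24), (421, 24), (433, 24),
    (449, 24), (467, 24), (479, 24), (491, 24), (509, 24), (523, 24), (541, 24), (563, 24),
    (577, 24), (601, 24), (619, 24), (643, 24), (661, 24), (683, 24), (709, 24), (733, 24),
    (761, 24), (787, 24), (811, 24), (839, 24), (863, 24), (887, 24), (919, 24), (953, 24),
    (991, 24), (1031, 24), (1069, 24), (1109, 24), (1153, 24), (1201, 24), (1249, 24),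
    (1301, 24), (1327, 24)]),
  (25, 9415, [
    (373, 25), (383, 25), (397, 25), (409, 25), (421, 25), (433, 25), (449, 25), (463, 25),
    (479, 25), (491, 25), (509, 25), (523, 25), (541, 25), (557, 25), (577, 25), (599, 25),
    (619, 25), (643, 25), (661, 25), (683, 25), (709, 25), (733, 25), (761, 25), (787, 25),
    (811, 25), (839, 25), (863, 25), (887, 25), (919, 25), (953, 25), (991, 25), (1021, 25),
    (1061, 25), (1103, 25), (1129, 25), (1171, 25), (1217, 25), (1259, 25), (1307, 25),
    (1327, 25)]),
  (26, 14045, [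
    (523, 26), (541, 26), (557, 26), (577, 26), (599, 26), (619, 26), (641, 26), (661, 26),
    (683, 26), (709, 26), (733, 26), (761, 26), (787, 26), (811, 26), (839, 26), (863, 26),
    (887, 26), (919, 26), (953, 26), (983, 26), (1019, 26), (1051, 26), (1091, 26), (1129, 26),
    (1171, 26), (1213, 26), (1259, 26), (1307, 26), (1327, 26)]),
  (27, 19931, [
    (733, 27), (757, 27), (773, 27), (797, 27), (823, 27), (853, 27), (883, 27), (911, 27),
    (941, 27), (971, 27), (997, 27), (1033, 27), (1069, 27), (1103, 27), (1129, 27), (1163, 27),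
    (1201, 27), (1237, 27), (1279, 27), (1321, 27)]),
  (28, 28283, [
    (1009, 28), (1039, 28), (1069, 28), (1103, 28), (1129, 28), (1163, 28), (1201, 28),
    (1237, 28), (1279, 28), (1321, 28)])]

/-- consecutive entries `p, q` satisfy `48 q ≤ 49 p`, and all are prime -/
def chainTest : List ℕ → Bool
  | [] => true
  | p :: l => primeTest p && (match l with
      | [] => Nat.ble 450000 p
      | q :: _ => Nat.ble (48 * q) (49 * p)) && chainTest l

theorem chainTest_spec {l : List ℕ} (h : chainTest l = true) {a x : ℕ} (ha : l.head? = some a)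
    (hx : a ≤ x) (hx2 : x < 450000) :
    ∃ p q : ℕ, p.Prime ∧ p ≤ x ∧ x < q ∧ 48 * q ≤ 49 * p ∧ a ≤ p := by
  induction l generalizing a with
  | nil => simp at ha
  | cons b l ih =>
    obtain rfl : b = a := by simpa using ha
    unfold chainTest at h
    simp only [Bool.and_eq_true] at h
    obtain ⟨⟨h1, h2⟩, h3⟩ := h
    cases l with
    | nil =>
      have := Nat.le_of_ble_eq_true h2
      omega
    | cons q l =>
      have h4 : 48 * q ≤ 49 * b := Nat.le_of_ble_eq_true h2
      by_cases hq : q ≤ x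
      · by_cases hbq : b ≤ q
        · obtain ⟨p, q', i1, i2, i3, i4, i5⟩ := ih h3 (a := q) rfl hq
          exact ⟨p, q', i1, i2, i3, i4, by omega⟩
        · obtain ⟨p, q', i1, i2, i3, i4, i5⟩ := ih h3 (a := q) rfl hq
          by_cases hbp : b ≤ p
          · exact ⟨p, q', i1, i2, i3, i4, hbp⟩
          · exact ⟨b, q', primeTest_spec h1, hx, i3, by omega, le_rfl⟩
      · exact ⟨b, q, primeTest_spec h1, hx, by omega, h4, le_rfl⟩

theorem chain_check : chainTest chainList = true := by decide +kernel

theorem not_int_chain {n r : ℕ} {m : ℤ} (hr : 2 ≤ r) (hr2 : r ≤ 48) (h1 : 1361 ≤ n / r)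
    (h2 : n / r < 450000) : esymH n r ≠ m := by
  intro h
  obtain ⟨p, q, i1, i2, i3, i4, i5⟩ := chainTest_spec chain_check (a := 1361) rfl h1 h2
  have hrpos : 0 < r := by omega
  have j1 : r * p ≤ n := by
    calc r * p ≤ r * (n / r) := Nat.mul_le_mul_left _ i2
      _ ≤ n := Nat.mul_div_le n r
  have j2 : n < (r + 1) * p := by
    have k1 : n < q * r := (Nat.div_lt_iff_lt_mul hrpos).1 i3
    nlinarith
  have := prime_dvd_numA i1 (by omega) h (by omega) j1 j2
  rw [numA_self] at this
  exact i1.one_lt.ne' (Nat.dvd_one.1 this)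

/-- The intervals `[N p, (N + 1) p)` cover `[s, e)`. -/
def coverTest (r e : ℕ) : ℕ → List (ℕ × ℕ) → Bool
  | s, [] => Nat.ble e s
  | s, (p, N) :: l => Nat.ble (N * p) s && primeTest p && Nat.ble (N + 1) p &&
      (Nat.beq N r || ndvdTest p N r) && coverTest r e ((N + 1) * p) l

theorem coverTest_spec {r e s : ℕ} {l : List (ℕ × ℕ)} (h : coverTest r e s l = true) {n : ℕ}
    {m : ℤ} (hr : 1 ≤ r) (hs : s ≤ n) (he : n < e) : esymH n r ≠ m := by
  induction l generalizing s with
  | nil => have := Nat.le_of_ble_eq_true h; omega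
  | cons a l ih =>
    obtain ⟨p, N⟩ := a
    simp only [coverTest, Bool.and_eq_true, Bool.or_eq_true] at h
    obtain ⟨⟨⟨⟨h1, h2⟩, h3⟩, h4⟩, h5⟩ := h
    by_cases hn : n < (N + 1) * p
    · intro hE
      have hp := primeTest_spec h2
      have hd := prime_dvd_numA hp hr hE (Nat.le_of_ble_eq_true h3)
        ((Nat.le_of_ble_eq_true h1).trans hs) hn
      rcases h4 with h4 | h4
      · have := Nat.eq_of_beq_eq_true h4
        subst this
        rw [numA_self] at hd
        exact hp.one_lt.ne' (Nat.dvd_one.1 hd)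
      · exact ndvdTest_spec h4 hd
    · exact ih h5 (by omega)

def coverAll : Bool := coverTable.all fun a => coverTest a.1 (1361 * a.1) a.2.1 a.2.2

theorem coverAll_check : coverAll = true := by decide +kernel

def boundAll : Bool := boundTable.all fun a =>
  Nat.ble (a.2.2 ^ 20 * 10 ^ (7 * a.2.1)) (27182818 ^ a.2.1) &&
  Nat.ble ((20 + a.2.1) ^ a.1 + 1) (a.1.factorial * 20 ^ a.1) && Nat.ble (20 + a.2.1) (20 * a.1)

theorem boundAll_check : boundAll = true := by decide +kernel

theorem bound_table {s k B : ℕ} (hmem : (s, k, B) ∈ boundTable)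
    {n r : ℕ} {m : ℤ} (hr1 : 1 ≤ r) (hrn : r ≤ n) (h : esymH n r = m) (hsr : s ≤ r) : B < n := by
  have h1 := boundAll_check
  unfold boundAll at h1
  rw [List.all_eq_true] at h1
  have h2 := h1 _ hmem
  simp only [Bool.and_eq_true] at h2
  obtain ⟨⟨h3, h4⟩, h5⟩ := h2
  exact bound_of_cert (Nat.le_of_ble_eq_true h3) (Nat.le_of_ble_eq_true h4)
    (Nat.le_of_ble_eq_true h5) hr1 hrn h hsr

theorem cover_table {r s n : ℕ} {l : List (ℕ × ℕ)} (hmem : (r, s, l) ∈ coverTable)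
    {m : ℤ} (hr : 1 ≤ r) (hs : s ≤ n) (he : n < 1361 * r) : esymH n r ≠ m := by
  have h1 := coverAll_check
  unfold coverAll at h1
  rw [List.all_eq_true] at h1
  exact coverTest_spec (h1 _ hmem) hr hs he

/-- every `2 ≤ r ≤ 28` occurs in the cover table, with a suitable starting point -/
def startTest : Bool := (List.range 29).all fun r => Nat.ble r 1 ||
  coverTable.any fun a => Nat.beq a.1 r && (Nat.ble a.2.1 401 ||
    boundTable.any fun b => Nat.beq b.1 r && Nat.ble a.2.1 (b.2.2 + 1))

theorem startTest_check : startTest = true := by decide +kernel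

theorem not_int_mid {n r : ℕ} {m : ℤ} (hr : 2 ≤ r) (hrn : r ≤ n) (hr2 : r ≤ 28) (h1 : 401 ≤ n)
    (h2 : n < 1361 * r) : esymH n r ≠ m := by
  intro h
  have h3 := startTest_check
  unfold startTest at h3
  rw [List.all_eq_true] at h3
  have h4 := h3 r (List.mem_range.2 (by omega))
  rw [Bool.or_eq_true] at h4
  rcases h4 with h4 | h4
  · have := Nat.le_of_ble_eq_true h4; omega
  rw [List.any_eq_true] at h4
  obtain ⟨⟨r', s, l⟩, hmem, h5⟩ := h4
  rw [Bool.and_eq_true, Bool.or_eq_true] at h5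
  obtain ⟨h6, h7⟩ := h5
  obtain rfl : r' = r := Nat.eq_of_beq_eq_true h6
  refine cover_table hmem (by omega) ?_ h2 h
  rcases h7 with h7 | h7
  · exact (Nat.le_of_ble_eq_true h7).trans h1
  · rw [List.any_eq_true] at h7
    obtain ⟨⟨t, k, B⟩, hb, h8⟩ := h7
    rw [Bool.and_eq_true] at h8
    have h9 : t = r' := Nat.eq_of_beq_eq_true h8.1
    have h10 : s ≤ B + 1 := Nat.le_of_ble_eq_true h8.2
    have := bound_table hb (by omega) hrn h (by omega)
    omega

theorem not_int_main {n r : ℕ} {m : ℤ} (hr : 2 ≤ r) (hrn : r ≤ n) (hn3 : n ≠ 3) :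
    esymH n r ≠ m := by
  intro h
  have hrpos : 0 < r := by omega
  by_cases hr48 : 49 ≤ r
  · have h1 := large_r hrn h hr48
    have h2 : 4 * r ^ 3 ≤ n / r := by
      rw [Nat.le_div_iff_mul_le hrpos]
      calc 4 * r ^ 3 * r = 4 * r ^ 4 := by ring
        _ ≤ n := h1
    have h3 : 49 ^ 3 ≤ r ^ 3 := Nat.pow_le_pow_left hr48 3
    exact not_int_large hr h2 (by omega) h
  push Not at hr48
  by_cases hx : 450000 ≤ n / r
  · have h3 : r ^ 3 ≤ 48 ^ 3 := Nat.pow_le_pow_left (by omega) 3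
    exact not_int_large hr (by omega) hx h
  by_cases hx2 : 1361 ≤ n / r
  · exact not_int_chain hr (by omega) hx2 (by omega) h
  have hn : n < 1361 * r := (Nat.div_lt_iff_lt_mul hrpos).1 (by omega)
  by_cases hr32 : 32 ≤ r
  · have := bound_table (s := 32) (k := 235) (B := 126753) (by decide +kernel) (by omega) hrn h hr32
    omega
  by_cases hr29 : 29 ≤ r
  · have := bound_table (s := 29) (k := 213) (B := 42192) (by decide +kernel) (by omega) hrn h hr29
    omega
  by_cases hn400 : 401 ≤ n
  · exact not_int_mid hr hrn (by omega) hn400 hn h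
  by_cases hr17 : 17 ≤ r
  · have := bound_table (s := 17) (k := 123) (B := 468) (by decide +kernel) (by omega) hrn h hr17
    omega
  exact not_int_small hr hrn (by omega) (by omega) hn3 h

/-- For `n ≥ r ≥ 1`, the `r`-th elementary symmetric function of `1, 1/2, …, 1/n`,
`H_n({1}^r) = ∑_{1 ≤ k₁ < ⋯ < k_r ≤ n} 1/(k₁⋯k_r)`, is an integer only for
`(n, r) = (1, 1)` and `(n, r) = (3, 2)`, where it equals `1` in both cases. -/
theorem elementary_symmetric_integer_iff (n r : ℕ) (hr : 1 ≤ r) (hn : r ≤ n) :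
    ((∃ m : ℤ, mhs n r (fun _ => 1) = (m : ℚ)) ↔
      (n = 1 ∧ r = 1) ∨ (n = 3 ∧ r = 2)) ∧
    ((n = 1 ∧ r = 1) ∨ (n = 3 ∧ r = 2) → mhs n r (fun _ => 1) = 1) := by
  have e11 : esymH 1 1 = 1 := by
    rw [esymH_succ, esymH_zero_succ, esymH_zero]; norm_num
  have e32 : esymH 3 2 = 1 := by
    have h := numA_eq 3 2
    have h2 : numA 3 2 = 6 := by decide
    rw [h2] at h
    norm_num [Nat.factorial] at h
    linarith
  have e33 : 6 * esymH 3 3 = 1 := by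
    have h := numA_eq 3 3
    have h2 : numA 3 3 = 1 := by decide
    rw [h2] at h
    norm_num [Nat.factorial] at h
    linarith
  rw [mhs_eq_esymH]
  have hback : (n = 1 ∧ r = 1) ∨ (n = 3 ∧ r = 2) → esymH n r = 1 := by
    rintro (⟨rfl, rfl⟩ | ⟨rfl, rfl⟩)
    · exact e11
    · exact e32
  refine ⟨⟨?_, fun h => ⟨1, by rw [hback h]; simp⟩⟩, hback⟩
  rintro ⟨m, hm⟩
  by_cases hr1 : r = 1
  · subst hr1
    left
    refine ⟨?_, rfl⟩
    by_contra hn1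
    rw [esymH_one] at hm
    have := harmonic_not_int (n := n) (by omega)
    rw [hm] at this
    exact this rfl
  by_cases hn3 : n = 3
  · subst hn3
    right
    refine ⟨rfl, ?_⟩
    by_contra hr2
    obtain rfl : r = 3 := by omega
    rw [hm] at e33
    have : 6 * m = 1 := by exact_mod_cast e33
    omega
  · exact absurd hm (not_int_main (by omega) hn hn3)
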